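/- Let t_n = 108^n · (1/6)_n · (1/3)_n / (n!)^2. For every prime p ≡ 1 (mod 6) and every positive integer n, t_{np} ≡ t_n (mod p^2). -/

import Mathlib

theorem Finset.sum_range_add_sum_range_sub {M : Type*} [AddCommMonoid M] (f : ℕ → M) {a b : ℕ}
    (h : a ≤ b) :
    ∑ i ∈ Finset.range a, f i + ∑ i ∈ Finset.range (b - a), f (a + i) =
      ∑ i ∈ Finset.range b, f i := by
  rw [← Finset.sum_range_add, Nat.add_sub_of_le h]

section TruncExp

variable {p : ℕ}

/-- The map `x ↦ 1 + p x` from `ℤ/p` to `ℤ/p²`, a homomorphism from the additive to the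
multiplicative structure. -/
def truncExp (p : ℕ) (x : ZMod p) : ZMod (p ^ 2) := 1 + p * (x.val : ZMod (p ^ 2))

theorem mul_intCast_eq_of_cast_eq {a b : ℤ} (h : (a : ZMod p) = b) :
    (p : ZMod (p ^ 2)) * a = p * b := by
  rw [ZMod.intCast_eq_intCast_iff_dvd_sub] at h
  obtain ⟨c, hc⟩ := h
  have : (((p : ℤ) * b : ℤ) : ZMod (p ^ 2)) = ((p * a : ℤ) : ZMod (p ^ 2)) := by
    rw [eq_comm, ZMod.intCast_eq_intCast_iff_dvd_sub]
    exact ⟨c, by push_cast; linear_combination (p : ℤ) * hc⟩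
  push_cast at this
  exact this.symm

theorem natCast_mul_natCast_self : (p : ZMod (p ^ 2)) * p = 0 := by
  have := ZMod.natCast_self (p ^ 2)
  push_cast at this
  rw [← sq, this]

variable [Fact p.Prime]

theorem truncExp_intCast (a : ℤ) : truncExp p a = 1 + p * (a : ZMod (p ^ 2)) := by
  have : (((a : ZMod p).val : ℤ) : ZMod p) = a := by simp
  have := mul_intCast_eq_of_cast_eq this
  push_cast at this
  rw [truncExp, this]

theorem truncExp_zero : truncExp p 0 = 1 := by simp [truncExp]

theorem truncExp_add (x y : ZMod p) : truncExp p (x + y) = truncExp p x * truncExp p y := by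
  obtain ⟨a, rfl⟩ := ZMod.intCast_surjective x
  obtain ⟨b, rfl⟩ := ZMod.intCast_surjective y
  rw [← Int.cast_add, truncExp_intCast, truncExp_intCast, truncExp_intCast]
  push_cast
  linear_combination (-(a : ZMod (p ^ 2)) * b) * natCast_mul_natCast_self (p := p)

theorem truncExp_sum {ι : Type*} (s : Finset ι) (f : ι → ZMod p) :
    truncExp p (∑ i ∈ s, f i) = ∏ i ∈ s, truncExp p (f i) := by
  classical
  induction s using Finset.induction_on with
  | empty => simp [truncExp_zero]
  | insert a s ha ih => rw [Finset.sum_insert ha, Finset.prod_insert ha, truncExp_add, ih]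

theorem intCast_add_mul_eq_mul_truncExp {a : ℤ} (b : ℤ) (ha : (a : ZMod p) ≠ 0) :
    ((a + p * b : ℤ) : ZMod (p ^ 2)) = a * truncExp p ((b : ZMod p) / (a : ZMod p)) := by
  obtain ⟨c, hc⟩ := ZMod.intCast_surjective ((b : ZMod p) / (a : ZMod p))
  have h : ((a * c : ℤ) : ZMod p) = b := by
    push_cast
    rw [hc]
    field_simp
  have := mul_intCast_eq_of_cast_eq h
  push_cast at this
  rw [← hc, truncExp_intCast]
  push_cast
  linear_combination -this

theorem prod_intCast_add_mul_eq {ι : Type*} (s : Finset ι) (a b : ι → ℤ)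
    (ha : ∀ i ∈ s, (a i : ZMod p) ≠ 0) :
    ∏ i ∈ s, ((a i + p * b i : ℤ) : ZMod (p ^ 2)) =
      (∏ i ∈ s, (a i : ZMod (p ^ 2))) * truncExp p (∑ i ∈ s, (b i : ZMod p) / a i) := by
  rw [truncExp_sum, ← Finset.prod_mul_distrib]
  exact Finset.prod_congr rfl fun i hi => intCast_add_mul_eq_mul_truncExp _ (ha i hi)

theorem isUnit_intCast_of_cast_ne_zero {a : ℤ} (ha : (a : ZMod p) ≠ 0) :
    IsUnit (a : ZMod (p ^ 2)) := by
  rw [Ne, ZMod.intCast_zmod_eq_zero_iff_dvd] at ha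
  have hp : Prime (p : ℤ) := Nat.prime_iff_prime_int.mp Fact.out
  have h : IsCoprime a ((p : ℤ) ^ 2) := ((hp.coprime_iff_not_dvd.mpr ha).symm).pow_right
  obtain ⟨u, v, huv⟩ := h
  have := congrArg (Int.cast : ℤ → ZMod (p ^ 2)) huv
  have hz := ZMod.natCast_self (p ^ 2)
  push_cast at this hz
  rw [hz, mul_zero, add_zero] at this
  exact .of_mul_eq_one_right _ this

theorem Finset.prod_range_natCast_zmod {M : Type*} [CommMonoid M] (f : ZMod p → M) :
    ∏ i ∈ Finset.range p, f i = ∏ x : ZMod p, f x := by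
  refine Finset.prod_bij (fun i _ => (i : ZMod p)) (fun _ _ => Finset.mem_univ _) ?_ ?_
    (fun _ _ => rfl)
  · intro i hi j hj h
    rw [Finset.mem_range] at hi hj
    rwa [ZMod.natCast_eq_natCast_iff', Nat.mod_eq_of_lt hi, Nat.mod_eq_of_lt hj] at h
  · exact fun x _ => ⟨x.val, Finset.mem_range.mpr x.val_lt, by simp⟩

theorem Finset.sum_range_natCast_zmod {M : Type*} [AddCommMonoid M] (f : ZMod p → M) :
    ∑ i ∈ Finset.range p, f i = ∑ x : ZMod p, f x :=
  Finset.prod_range_natCast_zmod (M := Multiplicative M) f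

theorem ZMod.sum_inv_eq_zero (h2 : p ≠ 2) : ∑ x : ZMod p, x⁻¹ = 0 := by
  have h : ∑ x : ZMod p, x⁻¹ = ∑ x : ZMod p, (-x)⁻¹ :=
    (Equiv.sum_comp (Equiv.neg (ZMod p)) fun x => x⁻¹).symm
  simp only [inv_neg, Finset.sum_neg_distrib] at h
  have h0 : (2 : ZMod p) ≠ 0 := by
    intro h
    have : ((2 : ℕ) : ZMod p) = 0 := by exact_mod_cast h
    rw [ZMod.natCast_eq_zero_iff, Nat.prime_dvd_prime_iff_eq Fact.out Nat.prime_two] at this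
    exact h2 this
  have h3 : (2 : ZMod p) * ∑ x : ZMod p, x⁻¹ = 0 := by linear_combination h
  exact (mul_eq_zero.mp h3).resolve_left h0

/-- The class of `(p - 1)!` modulo `p²`, as a product over nonzero residues. -/
def resProd (p : ℕ) [Fact p.Prime] : ZMod (p ^ 2) :=
  ∏ x : ZMod p, if x = 0 then 1 else (x.val : ZMod (p ^ 2))

theorem isUnit_resProd : IsUnit (resProd p) := by
  rw [resProd, IsUnit.prod_univ_iff]
  intro x
  split_ifs with h
  · exact isUnit_one
  · have : (((x.val : ℤ)) : ZMod p) ≠ 0 := by simpa using h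
    simpa using isUnit_intCast_of_cast_ne_zero this

theorem prod_affine_eq {m : ℤ} (c : ℤ) (hm : (m : ZMod p) ≠ 0) :
    ∏ i ∈ Finset.range p with ((m * (i : ℕ) + c : ℤ) : ZMod p) ≠ 0,
        ((m * i + c : ℤ) : ZMod (p ^ 2)) =
      resProd p * truncExp p (∑ i ∈ Finset.range p,
        (((m * i + c) / p : ℤ) : ZMod p) * ((m * i + c : ℤ) : ZMod p)⁻¹) := by
  have hmod (z : ℤ) : ((z % p : ℤ) : ZMod p) = z := by simp
  have hbij : Function.Bijective fun x : ZMod p => (m : ZMod p) * x + c :=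
    (Equiv.addRight (c : ZMod p)).bijective.comp (mulLeft_bijective₀ _ hm)
  have hU : ∏ i ∈ Finset.range p with ((m * (i : ℕ) + c : ℤ) : ZMod p) ≠ 0,
        (((m * i + c) % p : ℤ) : ZMod (p ^ 2)) = resProd p := by
    rw [resProd, ← hbij.prod_comp, ← Finset.prod_range_natCast_zmod, Finset.prod_filter]
    refine Finset.prod_congr rfl fun i _ => ?_
    have : ((m : ZMod p) * i + c) = ((m * i + c : ℤ) : ZMod p) := by push_cast; rfl
    simp only [this, ne_eq, ite_not]
    split_ifs with h
    · rfl
    · rw [← ZMod.val_intCast, Int.cast_natCast]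
  rw [← hU, Finset.prod_congr rfl fun i _ => by rw [← Int.emod_add_mul_ediv (m * i + c) p],
    prod_intCast_add_mul_eq]
  · congr 2
    simp only [hmod]
    rw [Finset.sum_filter]
    refine Finset.sum_congr rfl fun i _ => ?_
    split_ifs with h
    · rw [div_eq_mul_inv]
    · rw [not_not] at h
      rw [h, inv_zero, mul_zero]
  · intro i hi
    rw [hmod]
    exact (Finset.mem_filter.mp hi).2

/-- The harmonic number `H_a` modulo `p`. -/
def zmodHarmonic (p a : ℕ) : ZMod p := ∑ j ∈ Finset.range (a + 1), (j : ZMod p)⁻¹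

theorem zmodHarmonic_reflect (h2 : p ≠ 2) {a b : ℕ} (hab : a + b + 1 = p) :
    zmodHarmonic p a = zmodHarmonic p b := by
  have h0 : ∑ j ∈ Finset.range p, (j : ZMod p)⁻¹ = 0 := by
    rw [Finset.sum_range_natCast_zmod (fun x : ZMod p => x⁻¹), ZMod.sum_inv_eq_zero h2]
  have h1 : ∑ j ∈ Finset.range b, ((a + 1 + j : ℕ) : ZMod p)⁻¹ = -zmodHarmonic p b := by
    rw [zmodHarmonic, Finset.sum_range_succ', ← Finset.sum_range_reflect, Nat.cast_zero, inv_zero,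
      add_zero, ← Finset.sum_neg_distrib]
    refine Finset.sum_congr rfl fun j hj => ?_
    rw [Finset.mem_range] at hj
    rw [← inv_neg]
    congr 1
    have : ((a + 1 + (b - 1 - j) + (j + 1) : ℕ) : ZMod p) = 0 := by
      rw [show a + 1 + (b - 1 - j) + (j + 1) = p by omega, ZMod.natCast_self]
    rw [Nat.cast_add] at this
    exact eq_neg_of_add_eq_zero_left this
  have hs := Finset.sum_range_add (fun j : ℕ => (j : ZMod p)⁻¹) (a + 1) b
  rw [show a + 1 + b = p by omega, h0, h1, ← zmodHarmonic] at hs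
  linear_combination -hs

theorem intCast_sub_ne_zero_of_mem_erase {k i : ℕ} (hk : k < p)
    (hi : i ∈ (Finset.range p).erase k) : ((i - k : ℤ) : ZMod p) ≠ 0 := by
  rw [Finset.mem_erase, Finset.mem_range] at hi
  intro h
  rw [Int.cast_sub, sub_eq_zero, Int.cast_natCast, Int.cast_natCast,
    ZMod.natCast_eq_natCast_iff', Nat.mod_eq_of_lt hi.2, Nat.mod_eq_of_lt hk] at h
  exact hi.1 h

theorem filter_affine_eq_erase {m : ℤ} {k : ℕ} (hk : k < p) (hm : (m : ZMod p) ≠ 0) :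
    {i ∈ Finset.range p | ((m * (i : ℕ) + -(m * k) : ℤ) : ZMod p) ≠ 0} =
      (Finset.range p).erase k := by
  ext i
  rw [Finset.mem_filter, show m * (i : ℤ) + -(m * k) = m * (i - k) by ring, Int.cast_mul]
  constructor
  · rintro ⟨hi, h⟩
    refine Finset.mem_erase.mpr ⟨?_, hi⟩
    rintro rfl
    simp at h
  · intro hi
    exact ⟨Finset.mem_of_mem_erase hi, mul_ne_zero hm (intCast_sub_ne_zero_of_mem_erase hk hi)⟩

theorem prod_erase_sub_eq {k : ℕ} (hk : k < p) :
    ∏ i ∈ (Finset.range p).erase k, ((i - k : ℤ) : ZMod (p ^ 2)) =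
      resProd p * truncExp p (zmodHarmonic p k) := by
  have h := prod_affine_eq (p := p) (m := 1) (-(1 * (k : ℤ))) (by simp)
  rw [filter_affine_eq_erase hk (by simp)] at h
  simp only [one_mul, ← sub_eq_add_neg] at h
  rw [h, ← Finset.sum_range_add_sum_range_sub _ hk.le]
  congr 2
  rw [Finset.sum_eq_zero (s := Finset.range (p - k)), add_zero, zmodHarmonic,
    Finset.sum_range_succ', ← Finset.sum_range_reflect, Nat.cast_zero, inv_zero, add_zero]
  · refine Finset.sum_congr rfl fun i hi => ?_
    rw [Finset.mem_range] at hi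
    have : ((k - 1 - i : ℕ) : ℤ) = k - 1 - i := by omega
    have h1 : (((k - 1 - i : ℕ) : ℤ) - k) / (p : ℤ) = -1 := by
      rw [Int.ediv_eq_iff_of_pos (by omega)]
      constructor <;> omega
    have hcast : ((k - 1 - i - k : ℤ) : ZMod p) = -((i + 1 : ℕ) : ZMod p) := by
      push_cast
      ring
    rw [h1, this, hcast, inv_neg]
    simp
  · intro i hi
    rw [Finset.mem_range] at hi
    rw [Int.ediv_eq_zero_of_lt (by omega) (by omega), Int.cast_zero, zero_mul]

theorem sum_range_intCast_sub_inv_eq_zero (h2 : p ≠ 2) (c : ℤ) :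
    ∑ i ∈ Finset.range p, ((i - c : ℤ) : ZMod p)⁻¹ = 0 := by
  push_cast
  rw [Finset.sum_range_natCast_zmod (fun x : ZMod p => (x - c)⁻¹), ← ZMod.sum_inv_eq_zero h2]
  exact Equiv.sum_comp (Equiv.subRight (c : ZMod p)) fun x => x⁻¹

theorem intCast_ne_zero_of_mul_add_one_eq {d k : ℕ} (hdk : d * k + 1 = p) :
    ((d : ℤ) : ZMod p) ≠ 0 := by
  intro h
  have : ((d * k + 1 : ℕ) : ZMod p) = 0 := by rw [hdk, ZMod.natCast_self]
  push_cast at this h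
  rw [h] at this
  simp at this

theorem prod_erase_arith_eq (h2 : p ≠ 2) {d k : ℕ} (hdk : d * k + 1 = p) (j : ℤ) :
    ∏ i ∈ (Finset.range p).erase k, ((1 + d * (i + p * j) : ℤ) : ZMod (p ^ 2)) =
      d ^ (p - 1) * (resProd p * truncExp p (zmodHarmonic p k)) := by
  have hd := intCast_ne_zero_of_mul_add_one_eq hdk
  have hk : k < p := by
    have : d ≠ 0 := by rintro rfl; simp at hd
    have := Nat.le_mul_of_pos_left k (Nat.pos_of_ne_zero this)
    omega
  have hpz : (p : ℤ) = d * k + 1 := by exact_mod_cast hdk.symm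
  have hsum : ∑ i ∈ (Finset.range p).erase k,
      ((1 + d * j : ℤ) : ZMod p) / ((d * (i - k) : ℤ) : ZMod p) = 0 := by
    rw [Finset.sum_erase _ (by simp)]
    simp only [Int.cast_mul (d : ℤ), div_eq_mul_inv, mul_inv, ← Finset.mul_sum,
      sum_range_intCast_sub_inv_eq_zero h2, mul_zero]
  rw [Finset.prod_congr rfl fun i _ => by
      rw [show (1 + d * (i + p * j) : ℤ) = d * (i - k) + p * (1 + d * j) by
        rw [hpz]; ring],
    prod_intCast_add_mul_eq, hsum, truncExp_zero, mul_one, ← prod_erase_sub_eq hk]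
  · simp only [Int.cast_mul, Finset.prod_mul_distrib, Finset.prod_const,
      Finset.card_erase_of_mem (Finset.mem_range.mpr hk), Finset.card_range, Int.cast_natCast]
  · intro i hi
    rw [Int.cast_mul]
    exact mul_ne_zero hd (intCast_sub_ne_zero_of_mem_erase hk hi)

/-- Lerch's congruence for the Fermat quotient. -/
theorem pow_mul_truncExp_sum_zmodHarmonic (h2 : p ≠ 2) {m k : ℕ} (hmk : m * k + 1 = p) :
    (m : ZMod (p ^ 2)) ^ (p - 1) * truncExp p
      ((m : ZMod p)⁻¹ * ∑ c ∈ Finset.range (m - 1), zmodHarmonic p ((c + 1) * k)) = 1 := by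
  have hm := intCast_ne_zero_of_mul_add_one_eq hmk
  have hm0 : m ≠ 0 := by rintro rfl; simp at hm
  have hp0 : 0 < p := by omega
  have h := prod_affine_eq (p := p) (m := m) (-(m * (0 : ℕ))) hm
  rw [filter_affine_eq_erase hp0 hm] at h
  have h0 := prod_erase_sub_eq (p := p) hp0
  rw [show zmodHarmonic p 0 = 0 by simp [zmodHarmonic], truncExp_zero, mul_one] at h0
  simp only [Nat.cast_zero, mul_zero, neg_zero, add_zero, sub_zero] at h h0
  have hsum : ∑ i ∈ Finset.range p, ((m * (i : ℕ) / p : ℤ) : ZMod p) * ((m * i : ℤ) : ZMod p)⁻¹ =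
      -((m : ZMod p)⁻¹ * ∑ c ∈ Finset.range (m - 1), zmodHarmonic p ((c + 1) * k)) := by
    have hfloor : ∀ i ∈ Finset.range p, ((m * (i : ℕ) / p : ℤ) : ZMod p) =
        ∑ c ∈ Finset.range (m - 1), if i < (c + 1) * k + 1 then 0 else 1 := by
      intro i hi
      rw [Finset.mem_range] at hi
      have hlt : m * i / p < m := by
        rw [Nat.div_lt_iff_lt_mul hp0]
        exact Nat.mul_lt_mul_of_pos_left hi (Nat.pos_of_ne_zero hm0)
      have hfil : {c ∈ Finset.range (m - 1) | ¬ i < (c + 1) * k + 1} =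
          Finset.range (m * i / p) := by
        ext c
        rw [Finset.mem_filter, Finset.mem_range, Finset.mem_range, ← Nat.succ_le_iff (m := c) (n := m * i / p),
          Nat.le_div_iff_mul_le hp0]
        have hmul : c.succ * p = m * ((c + 1) * k) + (c + 1) := by
          rw [← hmk, Nat.succ_eq_add_one]; ring
        constructor
        · rintro ⟨hc, hic⟩
          have := Nat.mul_le_mul_left m (not_lt.mp hic)
          rw [hmul]
          linarith [show c + 1 ≤ m by omega]
        · intro hle
          have hc : c.succ ≤ m * i / p := (Nat.le_div_iff_mul_le hp0).mpr hle
          refine ⟨by omega, fun hlt' => ?_⟩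
          have := Nat.mul_le_mul_left m (Nat.lt_succ_iff.mp hlt')
          omega
      simp_rw [← ite_not (_ < _)]
      rw [← Finset.sum_filter, hfil]
      simp only [Finset.sum_const, Finset.card_range, nsmul_one]
      norm_cast
    rw [Finset.sum_congr rfl fun i hi => by
      rw [hfloor i hi, Int.cast_mul, mul_inv, mul_left_comm, Finset.sum_mul]]
    rw [← Finset.mul_sum, Finset.sum_comm, ← mul_neg, ← Finset.sum_neg_distrib, Int.cast_natCast]
    congr 1
    refine Finset.sum_congr rfl fun c hc => ?_
    rw [Finset.mem_range] at hc
    have hle : (c + 1) * k + 1 ≤ p := by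
      have := Nat.mul_le_mul_right k (show c + 1 ≤ m by omega)
      omega
    have hall := ZMod.sum_inv_eq_zero h2
    rw [← Finset.sum_range_natCast_zmod (fun x : ZMod p => x⁻¹),
      ← Finset.sum_range_add_sum_range_sub _ hle, ← zmodHarmonic] at hall
    rw [← Finset.sum_range_add_sum_range_sub _ hle,
      Finset.sum_eq_zero (s := Finset.range ((c + 1) * k + 1)), zero_add,
      ← eq_neg_of_add_eq_zero_right hall]
    · refine Finset.sum_congr rfl fun i _ => ?_
      rw [if_neg (by omega), one_mul, Int.cast_natCast]
    · intro i hi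
      rw [if_pos (Finset.mem_range.mp hi), zero_mul]
  rw [hsum] at h
  simp only [Int.cast_mul, Finset.prod_mul_distrib, Finset.prod_const, 
    Finset.card_erase_of_mem (Finset.mem_range.mpr hp0), Finset.card_range, Int.cast_natCast] at h
  simp only [Int.cast_natCast] at h0
  rw [h0] at h
  rw [mul_comm, isUnit_resProd.mul_right_inj] at h
  rw [h, ← truncExp_add, neg_add_cancel, truncExp_zero]

theorem pow_mul_truncExp_zmodHarmonic_add {k : ℕ} (hk : 6 * k + 1 = p) :
    (108 : ZMod (p ^ 2)) ^ (p - 1) *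
      truncExp p (zmodHarmonic p k + zmodHarmonic p (2 * k)) = 1 := by
  have h2 : p ≠ 2 := by omega
  have ne2 := intCast_ne_zero_of_mul_add_one_eq (show 2 * (3 * k) + 1 = p by omega)
  have ne6 := intCast_ne_zero_of_mul_add_one_eq hk
  have L6 := pow_mul_truncExp_sum_zmodHarmonic h2 hk
  have L2 := pow_mul_truncExp_sum_zmodHarmonic h2 (show 2 * (3 * k) + 1 = p by omega)
  push_cast at ne2 ne6
  simp only [Nat.add_one_sub_one, Finset.sum_range_succ, Finset.sum_range_zero,
    zero_add, one_mul, Nat.reduceAdd, Nat.cast_ofNat] at L6 L2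
  rw [zmodHarmonic_reflect h2 (show 5 * k + k + 1 = p by omega),
    zmodHarmonic_reflect h2 (show 4 * k + 2 * k + 1 = p by omega)] at L6
  set a := zmodHarmonic p k
  set b := zmodHarmonic p (2 * k)
  set c := zmodHarmonic p (3 * k)
  set x := (6 : ZMod p)⁻¹ * (a + b + c + b + a)
  have hx : a + b + 2⁻¹ * c = x + x + x := by
    have h3 : (6 : ZMod p) = 2 * 3 := by norm_num
    have ne3 : (3 : ZMod p) ≠ 0 := fun h => ne6 (by rw [h3, h, mul_zero])
    simp only [x, h3]
    field_simp
    ring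
  have h108 : (108 : ZMod (p ^ 2)) ^ (p - 1) * 2 ^ (p - 1) = (6 ^ (p - 1)) ^ 3 := by
    rw [← mul_pow, ← pow_mul, mul_comm (p - 1), pow_mul]
    norm_num
  calc _ = (108 : ZMod (p ^ 2)) ^ (p - 1) * truncExp p (a + b) *
        (2 ^ (p - 1) * truncExp p (2⁻¹ * c)) := by rw [L2, mul_one]
    _ = (108 : ZMod (p ^ 2)) ^ (p - 1) * 2 ^ (p - 1) * truncExp p (a + b + 2⁻¹ * c) := by
        rw [truncExp_add (a + b)]; ring
    _ = (6 ^ (p - 1) * truncExp p x) ^ 3 := by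
        rw [h108, hx, truncExp_add, truncExp_add]; ring
    _ = 1 := by rw [L6, one_pow]

/-- The product of the terms prime to `p` among `1 + d i`, `i < n p`, when `p = d k + 1`. -/
def primePart (p d k n : ℕ) : ℤ :=
  ∏ j ∈ Finset.range n, ∏ i ∈ (Finset.range p).erase k, (1 + d * (i + p * j) : ℤ)

theorem primePart_cast (h2 : p ≠ 2) {d k : ℕ} (hdk : d * k + 1 = p) (n : ℕ) :
    (primePart p d k n : ZMod (p ^ 2)) =
      (d ^ (p - 1) * (resProd p * truncExp p (zmodHarmonic p k))) ^ n := by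
  rw [primePart, Int.cast_prod]
  simp only [Int.cast_prod, prod_erase_arith_eq h2 hdk, Finset.prod_const, Finset.card_range]

end TruncExp

theorem prod_range_mul_arith {p d k : ℕ} (hk : k < p) (hdk : d * k + 1 = p) (n : ℕ) :
    ∏ i ∈ Finset.range (n * p), (1 + d * i : ℤ) =
      p ^ n * (∏ j ∈ Finset.range n, (1 + d * j : ℤ)) * primePart p d k n := by
  have hpz : (p : ℤ) = d * k + 1 := by exact_mod_cast hdk.symm
  induction n with
  | zero => simp [primePart]
  | succ n ih =>
    rw [Finset.prod_range_succ, primePart, Finset.prod_range_succ, ← primePart, add_mul, one_mul,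
      Finset.prod_range_add, ih, ← Finset.mul_prod_erase _ _ (Finset.mem_range.mpr hk)]
    have : (1 + d * ((n * p + k : ℕ) : ℤ)) = p * (1 + d * n) := by
      push_cast
      linear_combination (-1 : ℤ) * hpz
    have hshift (i : ℕ) : (1 + d * ((n * p + i : ℕ) : ℤ)) = 1 + d * (i + p * n) := by
      push_cast
      ring
    simp only [hshift] at this ⊢
    rw [this]
    ring

theorem pow_mul_ascPochhammer_eval_one_div {d : ℕ} (hd : d ≠ 0) (n : ℕ) :
    (d : ℚ) ^ n * (ascPochhammer ℚ n).eval (1 / d : ℚ) =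
      ((∏ i ∈ Finset.range n, (1 + d * i : ℤ) : ℤ) : ℚ) := by
  have : (d : ℚ) ≠ 0 := by exact_mod_cast hd
  induction n with
  | zero => simp
  | succ n ih =>
    rw [Finset.prod_range_succ, Int.cast_mul, ← ih, ascPochhammer_succ_eval]
    push_cast
    field_simp
    ring

theorem map_ascPochhammer_eval {S T : Type*} [CommSemiring S] [CommSemiring T] (f : S →+* T)
    (n : ℕ) (x : S) : f ((ascPochhammer S n).eval x) = (ascPochhammer T n).eval (f x) := by
  rw [← ascPochhammer_map f, Polynomial.eval_map_apply]

theorem padicNorm_ascPochhammer_div_factorial_le_one {p : ℕ} [Fact p.Prime] {x : ℚ}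
    (hx : padicNorm p x ≤ 1) (n : ℕ) :
    padicNorm p ((ascPochhammer ℚ n).eval x / n.factorial) ≤ 1 := by
  have hx' : ‖(x : ℚ_[p])‖ ≤ 1 := by rw [Padic.eq_padicNorm]; exact_mod_cast hx
  let u : ℤ_[p] := ⟨x, hx'⟩
  have h := Ring.factorial_nsmul_multichoose_eq_ascPochhammer u n
  rw [Polynomial.ascPochhammer_smeval_eq_eval, nsmul_eq_mul] at h
  have h1 := congrArg (PadicInt.Coe.ringHom (p := p)) h
  rw [map_ascPochhammer_eval, map_mul, map_natCast] at h1
  have hcast := map_ascPochhammer_eval (Rat.castHom ℚ_[p]) n x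
  have hu : PadicInt.Coe.ringHom u = Rat.castHom ℚ_[p] x := rfl
  have hn : (n.factorial : ℚ_[p]) ≠ 0 := by exact_mod_cast n.factorial_ne_zero
  have key : (((ascPochhammer ℚ n).eval x / n.factorial : ℚ) : ℚ_[p]) =
      (Ring.multichoose u n : ℤ_[p]) := by
    rw [hu, ← hcast] at h1
    push_cast
    rw [div_eq_iff hn, mul_comm]
    exact h1.symm
  have := PadicInt.norm_le_one (Ring.multichoose u n)
  rw [PadicInt.norm_def, ← key, Padic.eq_padicNorm] at this
  exact_mod_cast this

/-- Let `t_n = 108^n (1/6)_n (1/3)_n / (n!)^2`. For every prime `p ≡ 1 (mod 6)` and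
every positive integer `n`, `t_{np} ≡ t_n (mod p^2)`. -/
theorem t_np_cong (p : ℕ) (hp : p.Prime) (h6 : p % 6 = 1) (n : ℕ) (hn : 0 < n)
    (t : ℕ → ℚ)
    (ht : ∀ m, t m = (108 : ℚ) ^ m * (ascPochhammer ℚ m).eval (1/6)
      * (ascPochhammer ℚ m).eval (1/3) / (m.factorial : ℚ) ^ 2) :
    padicNorm p (t (n * p) - t n) ≤ (p : ℚ) ^ (-(2 : ℤ)) := by
  have : Fact p.Prime := ⟨hp⟩
  obtain ⟨k, hk⟩ : ∃ k, 6 * k + 1 = p := ⟨p / 6, by omega⟩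
  have hk3 : 3 * (2 * k) + 1 = p := by omega
  have hk1 : 1 * (p - 1) + 1 = p := by omega
  have h2 : p ≠ 2 := by omega
  have h7 : 6 < p := by
    have := hp.one_lt
    omega
  have t_eq (m : ℕ) : t m = 6 ^ m * ((∏ i ∈ Finset.range m, (1 + (6 : ℕ) * i : ℤ) : ℤ) : ℚ) *
      ((∏ i ∈ Finset.range m, (1 + (3 : ℕ) * i : ℤ) : ℤ) : ℚ) /
      ((∏ i ∈ Finset.range m, (1 + (1 : ℕ) * i : ℤ) : ℤ) : ℚ) ^ 2 := by
    have hfac : ((∏ i ∈ Finset.range m, (1 + (1 : ℕ) * i : ℤ) : ℤ) : ℚ) = m.factorial := by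
      rw [← Finset.prod_range_add_one_eq_factorial]
      push_cast
      exact Finset.prod_congr rfl fun i _ => by ring
    rw [ht, hfac, ← pow_mul_ascPochhammer_eval_one_div (by norm_num),
      ← pow_mul_ascPochhammer_eval_one_div (by norm_num),
      show (108 : ℚ) = 6 * (6 * 3) by norm_num, mul_pow, mul_pow]
    push_cast
    ring
  set G6 := primePart p 6 k n with hG6
  set G3 := primePart p 3 (2 * k) n with hG3
  set G1 := primePart p 1 (p - 1) n with hG1
  have c1 : (G1 : ZMod (p ^ 2)) = resProd p ^ n := by
    rw [hG1, primePart_cast h2 hk1,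
      zmodHarmonic_reflect h2 (a := p - 1) (b := 0) (by omega)]
    simp [zmodHarmonic, truncExp_zero]
  have hG1p : ¬ (p : ℤ) ∣ G1 := by
    intro h
    have h0 : (((G1 ^ 2 : ℤ)) : ZMod (p ^ 2)) = 0 := by
      rw [ZMod.intCast_zmod_eq_zero_iff_dvd]
      exact_mod_cast pow_dvd_pow_of_dvd h 2
    have : Nontrivial (ZMod (p ^ 2)) :=
      ZMod.nontrivial_iff.mpr (Nat.one_lt_pow two_ne_zero hp.one_lt).ne'
    rw [Int.cast_pow, c1] at h0
    exact ((isUnit_resProd.pow n).pow 2).ne_zero h0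
  have hdvd : ((p ^ 2 : ℕ) : ℤ) ∣ 6 ^ (n * (p - 1)) * G6 * G3 - G1 ^ 2 := by
    rw [← ZMod.intCast_zmod_eq_zero_iff_dvd]
    have hL := pow_mul_truncExp_zmodHarmonic_add hk
    rw [truncExp_add, show (108 : ZMod (p ^ 2)) = 6 * (6 * 3) by norm_num, mul_pow, mul_pow] at hL
    push_cast
    rw [c1, hG6, hG3, primePart_cast h2 hk, primePart_cast h2 hk3, sub_eq_zero]
    push_cast
    rw [mul_comm n, pow_mul, ← mul_pow, ← mul_pow, ← pow_mul, mul_comm n, pow_mul]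
    congr 1
    linear_combination (resProd p ^ 2) * hL
  have hp0 : (p : ℚ) ≠ 0 := by exact_mod_cast hp.ne_zero
  have hG0 : (G1 : ℚ) ≠ 0 := by
    intro h
    rw [Int.cast_eq_zero] at h
    exact hG1p (h ▸ dvd_zero _)
  have ht_mul : t (n * p) - t n =
      t n * ((6 ^ (n * (p - 1)) * G6 * G3 - G1 ^ 2 : ℤ) : ℚ) / (G1 : ℚ) ^ 2 := by
    have hpow : (6 : ℚ) ^ (n * p) = 6 ^ n * 6 ^ (n * (p - 1)) := by
      rw [← pow_add]
      congr 1
      obtain ⟨q, rfl⟩ : ∃ q, p = q + 1 := ⟨p - 1, by omega⟩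
      rw [Nat.add_sub_cancel]
      ring
    have hfac : ((∏ i ∈ Finset.range n, (1 + (1 : ℕ) * i : ℤ) : ℤ) : ℚ) ≠ 0 := by
      rw [Int.cast_ne_zero, Finset.prod_ne_zero_iff]
      intro i _
      positivity
    rw [t_eq, t_eq, prod_range_mul_arith (by omega) hk, prod_range_mul_arith (by omega) hk3,
      prod_range_mul_arith (by omega) hk1, ← hG6, ← hG3, ← hG1, hpow]
    generalize (∏ i ∈ Finset.range n, (1 + (1 : ℕ) * i : ℤ)) = F at hfac ⊢
    push_cast
    field_simp
  have htn : padicNorm p (t n) ≤ 1 := by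
    have hinv (d : ℕ) (h : ¬ p ∣ d) : padicNorm p (1 / d) ≤ 1 := by
      rw [padicNorm.div, padicNorm.one, (padicNorm.nat_eq_one_iff d).mpr h, div_one]
    have h108 : padicNorm p ((108 ^ n : ℕ) : ℚ) ≤ 1 := padicNorm.of_nat _
    have ha := padicNorm_ascPochhammer_div_factorial_le_one
      (hinv 6 (Nat.not_dvd_of_pos_of_lt (by norm_num) (by omega))) n
    have hb := padicNorm_ascPochhammer_div_factorial_le_one
      (hinv 3 (Nat.not_dvd_of_pos_of_lt (by norm_num) (by omega))) n
    rw [ht, mul_assoc, mul_div_assoc, sq, mul_div_mul_comm, padicNorm.mul, padicNorm.mul]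
    push_cast at ha hb h108
    exact mul_le_one₀ h108 (mul_nonneg (padicNorm.nonneg _) (padicNorm.nonneg _))
      (mul_le_one₀ ha (padicNorm.nonneg _) hb)
  rw [ht_mul, padicNorm.div, padicNorm.mul, sq (G1 : ℚ), padicNorm.mul (G1 : ℚ),
    (padicNorm.int_eq_one_iff G1).mpr hG1p, mul_one, div_one]
  exact (mul_le_of_le_one_left (padicNorm.nonneg _) htn).trans
    (by exact_mod_cast padicNorm.dvd_iff_norm_le.mp hdvd)
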